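/- Let d ≥ 3, n ≥ 1, and let A = ℂ[X_0,…,X_n]/(X_0^{d-1},…,X_n^{d-1}) with its grading, and let e ∈ A_1 be the class of X_0 + X_1 + ⋯ + X_n. Then for all nonnegative integers k and l ≥ 1 with 2k + l ≤ (d−2)(n+1), the multiplication map by e^l from A_k to A_{k+l} is injective. (This is the hard Lefschetz property of the cohomology ring of (P^{d-2})^{n+1}, which is the Jacobian ring of the Fermat polynomial Σ_i X_i^d.) -/

import Mathlib

open MvPolynomial

noncomputable section

abbrev S (n : ℕ) : Type := MvPolynomial (Fin (n + 1)) ℂ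

/-- The Jacobian ideal of `f`, generated by its partial derivatives. -/
def jacobianIdeal {n : ℕ} (f : S n) : Ideal (S n) :=
  Ideal.span (Set.range fun i => MvPolynomial.pderiv i f)

/-- The degree-`k` graded piece of `S/I`: the image of the homogeneous degree-`k`
polynomials in the quotient. -/
def quotPiece {n : ℕ} (I : Ideal (S n)) (k : ℕ) : Submodule ℂ (S n ⧸ I) :=
  (MvPolynomial.homogeneousSubmodule (Fin (n + 1)) ℂ k).map
    (Ideal.Quotient.mkₐ ℂ I).toLinearMap

/-- The degree-`k` graded piece `R_f^k` of the Jacobian ring `R_f = S/J_f`. -/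
def Rpiece {n : ℕ} (f : S n) (k : ℕ) : Submodule ℂ (S n ⧸ jacobianIdeal f) :=
  quotPiece (jacobianIdeal f) k

/-- `f` defines a smooth hypersurface: its partial derivatives have no common
zero in `ℂ^{n+1} \ {0}`. -/
def SmoothHyp {n : ℕ} (f : S n) : Prop :=
  ∀ v : Fin (n + 1) → ℂ, (∀ i, MvPolynomial.eval v (MvPolynomial.pderiv i f) = 0) → v = 0

/-- A polynomial function on a complex vector space: an element of the algebra of
functions generated by the linear functionals. -/
def IsPolyFun {M : Type} [AddCommGroup M] [Module ℂ M] (φ : M → ℂ) : Prop :=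
  φ ∈ Algebra.adjoin ℂ {ψ : M → ℂ | ∃ l : M →ₗ[ℂ] ℂ, ψ = ⇑l}

/-- A property `P` holds for generic points of `M`: it holds on a nonempty
Zariski-open subset, i.e. on the nonvanishing locus of some polynomial function
that is not identically zero. -/
def GenericallyHolds {M : Type} [AddCommGroup M] [Module ℂ M] (P : M → Prop) : Prop :=
  ∃ φ : M → ℂ, IsPolyFun φ ∧ (∃ x, φ x ≠ 0) ∧ ∀ x, φ x ≠ 0 → P x

/-- Substitution of the linear change of coordinates given by the matrix `A`. -/
def substLin {n : ℕ} (A : Matrix (Fin (n + 1)) (Fin (n + 1)) ℂ) (f : S n) : S n :=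
  MvPolynomial.aeval (fun i => ∑ j, A i j • MvPolynomial.X j) f

/-- A regular sequence: each `f i` is a nonzerodivisor modulo the previous ones. -/
def IsRegularSeq {n c : ℕ} (f : Fin c → S n) : Prop :=
  ∀ (i : Fin c) (g : S n),
    f i * g ∈ Ideal.span (f '' {j | j < i}) → g ∈ Ideal.span (f '' {j | j < i})

/-- Zariski-closed subset of a complex vector space: common zero locus of a set of
polynomial functions. -/
def IsZariskiClosed {M : Type} [AddCommGroup M] [Module ℂ M] (T : Set M) : Prop :=
  ∃ 𝒮 : Set (M → ℂ), (∀ φ ∈ 𝒮, IsPolyFun φ) ∧ T = {x | ∀ φ ∈ 𝒮, φ x = 0}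

/-- An irreducible Zariski-closed subset. -/
def IsIrredClosed {M : Type} [AddCommGroup M] [Module ℂ M] (Z : Set M) : Prop :=
  IsZariskiClosed Z ∧ Z.Nonempty ∧
    ∀ C₁ C₂ : Set M, IsZariskiClosed C₁ → IsZariskiClosed C₂ →
      Z ⊆ C₁ ∪ C₂ → Z ⊆ C₁ ∨ Z ⊆ C₂

/-- The (Krull) dimension of the algebraic set `T` is at least `m`: there is a strictly
increasing chain of `m+1` irreducible closed subsets contained in `T`. -/
def algDimGE {M : Type} [AddCommGroup M] [Module ℂ M] (T : Set M) (m : ℕ) : Prop :=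
  ∃ Z : Fin (m + 1) → Set M, StrictMono Z ∧ (∀ i, IsIrredClosed (Z i)) ∧
    Z (Fin.last m) ⊆ T


/-- The lowering operator `∑ i, (m ∂ᵢ - Xᵢ ∂ᵢ²)` of the `sl₂`-action for which multiplication by
`∑ i, Xᵢ` is the raising operator. -/
def lowering (n m : ℕ) : S n →ₗ[ℂ] S n :=
  ∑ i, ((m : ℂ) • (pderiv i : Derivation ℂ (S n) (S n)).toLinearMap -
    LinearMap.mulLeft ℂ (X i) ∘ₗ
      (pderiv i : Derivation ℂ (S n) (S n)).toLinearMap ∘ₗ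
        (pderiv i : Derivation ℂ (S n) (S n)).toLinearMap)

lemma lowering_apply (n m : ℕ) (p : S n) :
    lowering n m p = ∑ i, ((m : S n) * pderiv i p - X i * pderiv i (pderiv i p)) := by
  simp [lowering, LinearMap.sum_apply, MvPolynomial.smul_eq_C_mul]

lemma pderiv_eq_zero_of_isHomogeneous_zero {n : ℕ} {p : S n} (hp : p.IsHomogeneous 0)
    (i : Fin (n + 1)) : pderiv i p = 0 := by
  rw [totalDegree_eq_zero_iff_eq_C.mp (Nat.le_zero.mp hp.totalDegree_le), pderiv_C]

lemma lowering_eq_zero_of_isHomogeneous_zero {n m : ℕ} {p : S n} (hp : p.IsHomogeneous 0) :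
    lowering n m p = 0 := by
  simp [lowering_apply, pderiv_eq_zero_of_isHomogeneous_zero hp]

lemma lowering_isHomogeneous {n m k : ℕ} {p : S n} (hp : p.IsHomogeneous (k + 1)) :
    (lowering n m p).IsHomogeneous k := by
  rw [lowering_apply]
  refine IsHomogeneous.sum _ _ _ fun i _ => ?_
  have h₁ : (pderiv i p).IsHomogeneous k := hp.pderiv
  refine IsHomogeneous.sub ?_ ?_
  · simpa using (isHomogeneous_C _ (m : ℂ)).mul h₁
  · cases k with
    | zero => simpa [pderiv_eq_zero_of_isHomogeneous_zero h₁] using isHomogeneous_zero _ _ _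
    | succ k => simpa [add_comm] using (isHomogeneous_X ℂ i).mul (h₁.pderiv (i := i))

lemma lowering_sum_X_mul {n m k : ℕ} {p : S n} (hp : p.IsHomogeneous k) :
    lowering n m ((∑ i, X i) * p) =
      (∑ i, X i) * lowering n m p + ((m : S n) * ((n : S n) + 1) - 2 * (k : S n)) * p := by
  have hE : ∑ i, X i * pderiv i p = (k : S n) * p := by
    rw [hp.sum_X_mul_pderiv, nsmul_eq_mul]
  have h₁ : ∀ i : Fin (n + 1), pderiv i (∑ j, X j : S n) = 1 := fun i => by
    simp [pderiv_X, Pi.single_apply]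
  have h₂ : ∀ i : Fin (n + 1),
      (m : S n) * pderiv i ((∑ j, X j) * p) - X i * pderiv i (pderiv i ((∑ j, X j) * p)) =
        (∑ j, X j) * ((m : S n) * pderiv i p - X i * pderiv i (pderiv i p)) + (m : S n) * p -
          2 * (X i * pderiv i p) := fun i => by
    simp only [Derivation.leibniz, map_add, h₁, smul_eq_mul, Derivation.map_one_eq_zero]
    ring
  simp only [lowering_apply, h₂, Finset.sum_sub_distrib, Finset.sum_add_distrib, ← Finset.mul_sum,
    hE, Finset.sum_const, Finset.card_univ, Fintype.card_fin, nsmul_eq_mul]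
  push_cast
  ring

lemma sum_X_pow_mul_isHomogeneous {n k : ℕ} {p : S n} (hp : p.IsHomogeneous k) (l : ℕ) :
    ((∑ i, X i) ^ l * p : S n).IsHomogeneous (l + k) := by
  have h : (∑ i, X i : S n).IsHomogeneous 1 :=
    IsHomogeneous.sum _ _ _ fun i _ => isHomogeneous_X ℂ i
  simpa using (h.pow l).mul hp

lemma lowering_sum_X_pow_mul {n m k : ℕ} {p : S n} (hp : p.IsHomogeneous k) (l : ℕ) :
    lowering n m ((∑ i, X i) ^ (l + 1) * p) = (∑ i, X i) ^ (l + 1) * lowering n m p +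
      (((l : S n) + 1) * ((m : S n) * ((n : S n) + 1) - 2 * (k : S n) - (l : S n))) *
        ((∑ i, X i) ^ l * p) := by
  induction l with
  | zero => simpa using lowering_sum_X_mul (m := m) hp
  | succ l ih =>
    rw [pow_succ' _ (l + 1), mul_assoc,
      lowering_sum_X_mul (sum_X_pow_mul_isHomogeneous hp (l + 1)), ih]
    push_cast
    ring

lemma lowering_mem {n m : ℕ} {p : S n}
    (hp : p ∈ Ideal.span (Set.range fun i : Fin (n + 1) => (X i : S n) ^ (m + 1))) :
    lowering n m p ∈ Ideal.span (Set.range fun i : Fin (n + 1) => (X i : S n) ^ (m + 1)) := by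
  obtain ⟨c, rfl⟩ := Ideal.mem_span_range_iff_exists_fun.mp hp
  rw [map_sum]
  refine Ideal.sum_mem _ fun i _ => ?_
  rw [lowering_apply]
  refine Ideal.sum_mem _ fun j _ => ?_
  refine Ideal.mem_of_dvd _ ?_ (Ideal.subset_span (Set.mem_range_self i))
  rcases eq_or_ne j i with rfl | hij
  · refine ⟨(m : S n) * pderiv j (c j) - X j * pderiv j (pderiv j (c j)) -
      2 * ((m : S n) + 1) * pderiv j (c j), ?_⟩
    cases m with
    | zero =>
      simp [Derivation.leibniz]
      ring
    | succ m =>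
      simp [Derivation.leibniz, Derivation.leibniz_pow]
      ring
  · have h : pderiv j ((X i : S n) ^ (m + 1)) = 0 := by
      simp [Derivation.leibniz_pow, pderiv_X_of_ne hij.symm]
    refine ⟨(m : S n) * pderiv j (c i) - X j * pderiv j (pderiv j (c i)), ?_⟩
    simp only [Derivation.leibniz, h, smul_eq_mul, mul_zero, zero_add]
    ring

lemma mem_of_lowering_mem {n m k l : ℕ} (hkl : 2 * k + (l + 1) ≤ m * (n + 1)) {p : S n}
    (hp : p.IsHomogeneous k)
    (h : (∑ i, X i) ^ (l + 1) * p ∈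
      Ideal.span (Set.range fun i : Fin (n + 1) => (X i : S n) ^ (m + 1)))
    (hF : lowering n m p ∈
      Ideal.span (Set.range fun i : Fin (n + 1) => (X i : S n) ^ (m + 1))) :
    (∑ i, X i) ^ l * p ∈
      Ideal.span (Set.range fun i : Fin (n + 1) => (X i : S n) ^ (m + 1)) := by
  have h₁ := lowering_mem h
  rw [lowering_sum_X_pow_mul hp] at h₁
  have h₂ := (Ideal.add_mem_iff_right _ (Ideal.mul_mem_left _ _ hF)).mp h₁
  obtain ⟨r, hr⟩ := Nat.exists_eq_add_of_le hkl
  have hc : ((l : S n) + 1) * ((m : S n) * ((n : S n) + 1) - 2 * (k : S n) - (l : S n)) =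
      C (((l + 1) * (r + 1) : ℕ) : ℂ) := by
    have hr' : (m : S n) * ((n : S n) + 1) = 2 * (k : S n) + ((l : S n) + 1) + (r : S n) := by
      exact_mod_cast congrArg (Nat.cast (R := S n)) hr
    rw [hr', map_natCast]
    push_cast
    ring
  rw [hc] at h₂
  have hu : IsUnit (C (((l + 1) * (r + 1) : ℕ) : ℂ) : S n) :=
    (isUnit_iff_ne_zero.mpr (Nat.cast_ne_zero.mpr (by positivity))).map C
  exact (Ideal.unit_mul_mem_iff_mem _ hu).mp h₂

lemma mem_of_sum_X_pow_mul_mem {n m : ℕ} (k l : ℕ) (hkl : 2 * k + l ≤ m * (n + 1)) {p : S n}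
    (hp : p.IsHomogeneous k)
    (h : (∑ i, X i) ^ l * p ∈
      Ideal.span (Set.range fun i : Fin (n + 1) => (X i : S n) ^ (m + 1))) :
    p ∈ Ideal.span (Set.range fun i : Fin (n + 1) => (X i : S n) ^ (m + 1)) := by
  induction k generalizing l p with
  | zero =>
    induction l with
    | zero => simpa using h
    | succ l ihl =>
      refine ihl (by lia) (mem_of_lowering_mem hkl hp h ?_)
      simp [lowering_eq_zero_of_isHomogeneous_zero hp]
  | succ k ihk =>
    induction l with
    | zero => simpa using h
    | succ l ihl =>
      refine ihl (by lia) (mem_of_lowering_mem hkl hp h ?_)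
      refine ihk (l + 2) (by lia) (lowering_isHomogeneous hp) ?_
      have h₁ := Ideal.mul_mem_left _ (∑ i, X i) (lowering_mem h)
      rw [lowering_sum_X_pow_mul hp] at h₁
      convert Ideal.sub_mem _ h₁ (Ideal.mul_mem_left _
        (((l : S n) + 1) *
          ((m : S n) * ((n : S n) + 1) - 2 * ((k + 1 : ℕ) : S n) - (l : S n))) h) using 1
      ring

/-- hard Lefschetz for the Fermat Jacobian ring.
Let `A = ℂ[X₀,…,Xₙ]/(X₀^{d-1},…,Xₙ^{d-1})` and `e = X₀ + ⋯ + Xₙ`. For all `k` and `l ≥ 1`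
with `2k + l ≤ (d-2)(n+1)`, multiplication by `e^l` is injective from `A_k` to `A_{k+l}`. -/
theorem fermat_hard_lefschetz (n d : ℕ) (hd : 3 ≤ d) (hn : 1 ≤ n) :
    ∀ k l : ℕ, 1 ≤ l → 2 * k + l ≤ (d - 2) * (n + 1) →
      ∀ p : S n, p.IsHomogeneous k →
        (∑ i, MvPolynomial.X i) ^ l * p ∈
          Ideal.span (Set.range fun i : Fin (n + 1) => (MvPolynomial.X i : S n) ^ (d - 1)) →
        p ∈ Ideal.span (Set.range fun i : Fin (n + 1) => (MvPolynomial.X i : S n) ^ (d - 1)) := by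
  intro k l _ hkl p hp h
  obtain ⟨m, rfl⟩ := Nat.exists_eq_add_of_le' (show 2 ≤ d by lia)
  exact mem_of_sum_X_pow_mul_mem k l hkl hp h

end
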